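/- Let Π be the set of all deterministic policies, |Π| = |A|^{|S|}, and let (s⁽¹⁾,a⁽¹⁾),…,(s⁽ᵐ⁾,a⁽ᵐ⁾) be m i.i.d. samples from ρ_{π_E}. Assume the reward function is bounded in absolute value by R_max. Then for any δ > 0, with probability at least 1−δ over the draw of the samples, simultaneously for every deterministic policy π_bc ∈ Π: |V^{π_bc} − V^{π_E}| ≤ (2 R_max/(1-γ)²) · ( (1/m)∑_{i=1}^m 𝟙[π_bc(s⁽ⁱ⁾) ≠ a⁽ⁱ⁾] + √( (log|Π| + log(2/δ)) / (2m) ) ). -/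

import Mathlib

open scoped BigOperators
open MeasureTheory

/-- A probability vector on a finite type: nonnegative entries summing to 1. -/
def IsProbVec {X : Type*} [Fintype X] (p : X → ℝ) : Prop :=
  (∀ x, 0 ≤ p x) ∧ ∑ x, p x = 1

/-- A stationary policy assigns to each state a probability distribution over actions. -/
def IsPolicy {S A : Type*} [Fintype A] (π : S → A → ℝ) : Prop :=
  ∀ s, IsProbVec (π s)

/-- A transition kernel assigns to each state-action pair a distribution over next states. -/
def IsKernel {S A : Type*} [Fintype S] (P : S → A → S → ℝ) : Prop :=
  ∀ s a, IsProbVec (P s a)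

/-- `stateDist P π d0 t s = Pr(s_t = s ; π, d0)`. -/
noncomputable def stateDist {S A : Type*} [Fintype S] [Fintype A]
    (P : S → A → S → ℝ) (π : S → A → ℝ) (d0 : S → ℝ) : ℕ → S → ℝ
  | 0 => d0
  | t + 1 => fun s' => ∑ s, ∑ a, stateDist P π d0 t s * π s a * P s a s'

/-- Discounted state distribution `d_π(s) = (1-γ) ∑_t γ^t Pr(s_t = s ; π, d0)`. -/
noncomputable def discStateDist {S A : Type*} [Fintype S] [Fintype A] (γ : ℝ)
    (P : S → A → S → ℝ) (π : S → A → ℝ) (d0 : S → ℝ) : S → ℝ :=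
  fun s => (1 - γ) * ∑' t : ℕ, γ ^ t * stateDist P π d0 t s

/-- Discounted state-action distribution
`ρ_π(s,a) = (1-γ) ∑_t γ^t Pr(s_t = s, a_t = a ; π, d0)`. -/
noncomputable def discSADist {S A : Type*} [Fintype S] [Fintype A] (γ : ℝ)
    (P : S → A → S → ℝ) (π : S → A → ℝ) (d0 : S → ℝ) : S × A → ℝ :=
  fun x => (1 - γ) * ∑' t : ℕ, γ ^ t * (stateDist P π d0 t x.1 * π x.1 x.2)

/-- Total variation distance `D_TV(P,Q) = (1/2) ∑_x |P(x) - Q(x)|`. -/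
noncomputable def DTV {X : Type*} [Fintype X] (p q : X → ℝ) : ℝ :=
  (1 / 2) * ∑ x, |p x - q x|

/-- Policy value `V^π = E[∑_t γ^t r(s_t,a_t)]`. -/
noncomputable def policyValue {S A : Type*} [Fintype S] [Fintype A] (γ : ℝ)
    (P : S → A → S → ℝ) (r : S → A → ℝ) (π : S → A → ℝ) (d0 : S → ℝ) : ℝ :=
  ∑' t : ℕ, γ ^ t * ∑ s, ∑ a, stateDist P π d0 t s * π s a * r s a

/-- The stationary policy induced by a deterministic policy `f : S → A`. -/
noncomputable def detPol {S A : Type*} [DecidableEq A] (f : S → A) : S → A → ℝ :=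
  fun s a => if a = f s then 1 else 0


lemma aux_stateDist {S A : Type*} [Fintype S] [Fintype A]
    (P : S → A → S → ℝ) (hP : IsKernel P) (d0 : S → ℝ) (hd0 : IsProbVec d0)
    (π : S → A → ℝ) (hπ : IsPolicy π) (t : ℕ) : IsProbVec (stateDist P π d0 t) := by
  induction t with
  | zero => exact hd0
  | succ t ih =>
    refine ⟨fun s' => ?_, ?_⟩
    · exact Finset.sum_nonneg fun s _ => Finset.sum_nonneg fun a _ =>
        mul_nonneg (mul_nonneg (ih.1 s) ((hπ s).1 a)) ((hP s a).1 s')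
    · simp only [stateDist]
      rw [Finset.sum_comm]
      rw [← ih.2]
      refine Finset.sum_congr rfl fun s _ => ?_
      rw [Finset.sum_comm]
      simp_rw [← Finset.mul_sum, (hP _ _).2, mul_one]
      rw [← Finset.mul_sum, (hπ s).2, mul_one]

lemma aux_detPol {S A : Type*} [Fintype A] [DecidableEq A] (f : S → A) :
    IsPolicy (detPol f) := by
  intro s
  refine ⟨fun a => ?_, ?_⟩
  · unfold detPol; split_ifs <;> norm_num
  · simp [detPol]

lemma aux_l1 {S A : Type*} [Fintype A] [DecidableEq A] (f : S → A) (π : S → A → ℝ)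
    (hπ : IsPolicy π) (s : S) :
    ∑ a, |π s a - detPol f s a| = 2 * ∑ a, π s a * (if f s ≠ a then (1 : ℝ) else 0) := by
  have h1 : ∀ a, |π s a - detPol f s a| =
      2 * (π s a * (if f s ≠ a then (1 : ℝ) else 0)) + (detPol f s a - π s a) := by
    intro a
    have h0 := (hπ s).1 a
    have h2 : π s a ≤ 1 := by
      rw [← (hπ s).2]
      exact Finset.single_le_sum (fun b _ => (hπ s).1 b) (Finset.mem_univ a)
    unfold detPol
    by_cases h : a = f s
    · subst h
      simp only [if_true, ne_eq, not_true, if_false]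
      rw [abs_of_nonpos (by linarith)]; ring
    · have h' : f s ≠ a := fun h' => h h'.symm
      simp only [h, h', if_false, ne_eq, not_false_eq_true, if_true]
      rw [sub_zero, abs_of_nonneg h0]; ring
  simp_rw [h1]
  rw [Finset.sum_add_distrib, Finset.sum_sub_distrib, (hπ s).2, (aux_detPol f s).2,
    ← Finset.mul_sum]
  ring

lemma aux_summable (γ : ℝ) (hγ0 : 0 < γ) (hγ1 : γ < 1) (u : ℕ → ℝ) (C : ℝ)
    (hu : ∀ t, |u t| ≤ C) : Summable fun t => γ ^ t * u t := by
  refine Summable.of_norm_bounded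
    (g := fun t => γ ^ t * C) ((summable_geometric_of_lt_one hγ0.le hγ1).mul_right C) ?_
  intro t
  rw [Real.norm_eq_abs, abs_mul, abs_of_nonneg (pow_nonneg hγ0.le t)]
  exact mul_le_mul_of_nonneg_left (hu t) (pow_nonneg hγ0.le t)

lemma aux_sa {S A : Type*} [Fintype S] [Fintype A]
    (p : S → ℝ) (hp : IsProbVec p) (π : S → A → ℝ) (hπ : IsPolicy π) :
    ∑ s, ∑ a, p s * π s a = 1 := by
  simp_rw [← Finset.mul_sum, (hπ _).2, mul_one, hp.2]

lemma aux_rho {S A : Type*} [Fintype S] [Fintype A]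
    (γ : ℝ) (hγ0 : 0 < γ) (hγ1 : γ < 1)
    (P : S → A → S → ℝ) (hP : IsKernel P) (d0 : S → ℝ) (hd0 : IsProbVec d0)
    (π : S → A → ℝ) (hπ : IsPolicy π) (g : S → A → ℝ) :
    ∑ x : S × A, discSADist γ P π d0 x * g x.1 x.2 =
      (1 - γ) * ∑' t : ℕ, γ ^ t * ∑ s, ∑ a, stateDist P π d0 t s * π s a * g s a := by
  have hp := aux_stateDist P hP d0 hd0 π hπ
  have h1 : ∀ x : S × A, Summable fun t => γ ^ t * (stateDist P π d0 t x.1 * π x.1 x.2) := by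
    intro x
    refine aux_summable γ hγ0 hγ1 _ 1 fun t => ?_
    rw [abs_of_nonneg (mul_nonneg ((hp t).1 _) ((hπ _).1 _))]
    have h2 : π x.1 x.2 ≤ 1 := by
      rw [← (hπ x.1).2]
      exact Finset.single_le_sum (fun b _ => (hπ x.1).1 b) (Finset.mem_univ x.2)
    have h3 : stateDist P π d0 t x.1 ≤ 1 := by
      rw [← (hp t).2]
      exact Finset.single_le_sum (fun b _ => (hp t).1 b) (Finset.mem_univ x.1)
    exact mul_le_one₀ h3 ((hπ _).1 _) h2
  have h4 : ∀ t, γ ^ t * ∑ s, ∑ a, stateDist P π d0 t s * π s a * g s a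
      = ∑ x : S × A, γ ^ t * (stateDist P π d0 t x.1 * π x.1 x.2) * g x.1 x.2 := by
    intro t
    rw [Fintype.sum_prod_type, Finset.mul_sum]
    refine Finset.sum_congr rfl fun s _ => ?_
    rw [Finset.mul_sum]
    refine Finset.sum_congr rfl fun a _ => ?_
    ring
  simp_rw [h4]
  rw [Summable.tsum_finsetSum (fun x _ => (h1 x).mul_right _), Finset.mul_sum]
  refine Finset.sum_congr rfl fun x _ => ?_
  rw [tsum_mul_right]
  unfold discSADist
  ring

lemma aux_rho_prob {S A : Type*} [Fintype S] [Fintype A]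
    (γ : ℝ) (hγ0 : 0 < γ) (hγ1 : γ < 1)
    (P : S → A → S → ℝ) (hP : IsKernel P) (d0 : S → ℝ) (hd0 : IsProbVec d0)
    (π : S → A → ℝ) (hπ : IsPolicy π) : IsProbVec (discSADist γ P π d0) := by
  have hp := aux_stateDist P hP d0 hd0 π hπ
  refine ⟨fun x => ?_, ?_⟩
  · unfold discSADist
    exact mul_nonneg (by linarith) (tsum_nonneg fun t =>
      mul_nonneg (pow_nonneg hγ0.le t) (mul_nonneg ((hp t).1 _) ((hπ _).1 _)))
  · have h := aux_rho γ hγ0 hγ1 P hP d0 hd0 π hπ (fun _ _ => 1)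
    simp only [mul_one] at h
    rw [h]
    simp_rw [aux_sa _ (hp _) π hπ, mul_one]
    rw [tsum_geometric_of_lt_one hγ0.le hγ1]
    exact mul_inv_cancel₀ (by linarith)

lemma aux_rec (γ : ℝ) (hγ0 : 0 < γ) (b c : ℕ → ℝ)
    (hsb : Summable fun t => γ ^ t * b t) (hsc : Summable fun t => γ ^ t * c t)
    (hc00 : c 0 ≤ 2 * b 0) (hc : ∀ t, c (t+1) ≤ c t + 2 * b (t+1)) :
    ∑' t, γ ^ t * c t ≤ γ * ∑' t, γ ^ t * c t + 2 * ∑' t, γ ^ t * b t := by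
  have hs1 : Summable fun t => γ ^ (t+1) * b (t+1) := (summable_nat_add_iff 1).2 hsb
  have hs2 : Summable fun t => γ ^ (t+1) * c (t+1) := (summable_nat_add_iff 1).2 hsc
  have h1 : ∑' t, γ ^ (t+1) * c (t+1) ≤
      ∑' t, (γ * (γ ^ t * c t) + 2 * (γ ^ (t+1) * b (t+1))) := by
    refine hs2.tsum_le_tsum (fun t => ?_) ((hsc.mul_left γ).add (hs1.mul_left 2))
    have : c (t+1) ≤ c t + 2 * b (t+1) := hc t
    have := mul_le_mul_of_nonneg_left this (pow_nonneg hγ0.le (t+1))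
    refine this.trans (le_of_eq ?_)
    ring
  rw [(hsc.mul_left γ).tsum_add (hs1.mul_left 2), tsum_mul_left, tsum_mul_left] at h1
  have e1 := hsb.tsum_eq_zero_add
  have e2 := hsc.tsum_eq_zero_add
  simp only [pow_zero, one_mul] at e1 e2
  rw [e1]
  linarith

lemma aux_det {S A : Type*} [Fintype S] [Fintype A] [DecidableEq A]
    (γ : ℝ) (hγ0 : 0 < γ) (hγ1 : γ < 1)
    (P : S → A → S → ℝ) (hP : IsKernel P)
    (d0 : S → ℝ) (hd0 : IsProbVec d0)
    (r : S → A → ℝ) (Rmax : ℝ) (hR : 0 ≤ Rmax) (hr : ∀ s a, |r s a| ≤ Rmax)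
    (πE : S → A → ℝ) (hπE : IsPolicy πE) (f : S → A) :
    |policyValue γ P r (detPol f) d0 - policyValue γ P r πE d0| ≤
      2 * Rmax / (1 - γ) ^ 2 *
        ∑ x : S × A, discSADist γ P πE d0 x * (if f x.1 ≠ x.2 then (1 : ℝ) else 0) := by
  have hg : 0 < 1 - γ := by linarith
  have hf := aux_detPol f
  have hp := aux_stateDist P hP d0 hd0 πE hπE
  have hq := aux_stateDist P hP d0 hd0 (detPol f) hf
  set p := stateDist P πE d0 with hpdef
  set q := stateDist P (detPol f) d0 with hqdef
  let b : ℕ → ℝ := fun t => ∑ s, ∑ a, p t s * πE s a * (if f s ≠ a then (1 : ℝ) else 0)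
  let c : ℕ → ℝ := fun t => ∑ s, ∑ a, |p t s * πE s a - q t s * detPol f s a|
  have hb0 : ∀ t, 0 ≤ b t := fun t => Finset.sum_nonneg fun s _ => Finset.sum_nonneg fun a _ =>
    mul_nonneg (mul_nonneg ((hp t).1 _) ((hπE _).1 _)) (by split_ifs <;> norm_num)
  have hc0 : ∀ t, 0 ≤ c t := fun t => Finset.sum_nonneg fun s _ => Finset.sum_nonneg fun a _ =>
    abs_nonneg _
  have hb1 : ∀ t, b t ≤ 1 := by
    intro t
    rw [← aux_sa _ (hp t) πE hπE]
    refine Finset.sum_le_sum fun s _ => Finset.sum_le_sum fun a _ => ?_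
    refine mul_le_of_le_one_right (mul_nonneg ((hp t).1 _) ((hπE _).1 _)) ?_
    split_ifs <;> norm_num
  have hc1 : ∀ t, c t ≤ 2 := by
    intro t
    have : c t ≤ ∑ s, ∑ a, (p t s * πE s a + q t s * detPol f s a) := by
      refine Finset.sum_le_sum fun s _ => Finset.sum_le_sum fun a _ => ?_
      refine (abs_sub _ _).trans ?_
      rw [abs_of_nonneg (mul_nonneg ((hp t).1 _) ((hπE _).1 _)),
        abs_of_nonneg (mul_nonneg ((hq t).1 _) ((hf _).1 _))]
    simp_rw [Finset.sum_add_distrib] at this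
    rw [aux_sa _ (hp t) πE hπE, aux_sa _ (hq t) _ hf] at this
    linarith
  have hce : ∀ t, c t ≤ ∑ s, |p t s - q t s| + 2 * b t := by
    intro t
    have h1 : c t ≤ ∑ s, ∑ a, (|p t s - q t s| * detPol f s a
        + p t s * |πE s a - detPol f s a|) := by
      refine Finset.sum_le_sum fun s _ => Finset.sum_le_sum fun a _ => ?_
      have : p t s * πE s a - q t s * detPol f s a =
        (p t s - q t s) * detPol f s a + p t s * (πE s a - detPol f s a) := by ring
      rw [this]
      refine (abs_add_le _ _).trans ?_
      rw [abs_mul, abs_mul, abs_of_nonneg ((hf s).1 a), abs_of_nonneg ((hp t).1 s)]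
    refine h1.trans (le_of_eq ?_)
    simp_rw [Finset.sum_add_distrib, ← Finset.mul_sum, (hf _).2, mul_one, aux_l1 f πE hπE]
    congr 1
    simp only [b]
    rw [Finset.mul_sum]
    refine Finset.sum_congr rfl fun s _ => ?_
    simp_rw [mul_assoc, ← Finset.mul_sum]
    ring
  have hec : ∀ t, ∑ s, |p (t+1) s - q (t+1) s| ≤ c t := by
    intro t
    have h1 : ∀ s', |p (t+1) s' - q (t+1) s'| ≤
        ∑ s, ∑ a, |p t s * πE s a - q t s * detPol f s a| * P s a s' := by
      intro s'
      have : p (t+1) s' - q (t+1) s' =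
          ∑ s, ∑ a, (p t s * πE s a - q t s * detPol f s a) * P s a s' := by
        simp only [hpdef, hqdef, stateDist]
        simp_rw [← Finset.sum_sub_distrib, sub_mul]
      rw [this]
      refine (Finset.abs_sum_le_sum_abs _ _).trans (Finset.sum_le_sum fun s _ => ?_)
      refine (Finset.abs_sum_le_sum_abs _ _).trans (Finset.sum_le_sum fun a _ => ?_)
      rw [abs_mul, abs_of_nonneg ((hP s a).1 s')]
    refine (Finset.sum_le_sum fun s' _ => h1 s').trans (le_of_eq ?_)
    rw [Finset.sum_comm]
    refine Finset.sum_congr rfl fun s _ => ?_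
    rw [Finset.sum_comm]
    simp_rw [← Finset.mul_sum, (hP _ _).2, mul_one]
  have hsb : Summable fun t => γ ^ t * b t := aux_summable γ hγ0 hγ1 b 1 fun t => by
    rw [abs_of_nonneg (hb0 t)]; exact hb1 t
  have hsc : Summable fun t => γ ^ t * c t := aux_summable γ hγ0 hγ1 c 2 fun t => by
    rw [abs_of_nonneg (hc0 t)]; exact hc1 t
  have hc00 : c 0 ≤ 2 * b 0 := by
    have := hce 0
    simpa [hpdef, hqdef, stateDist] using this
  have hC := aux_rec γ hγ0 b c hsb hsc hc00 fun t =>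
    (hce (t+1)).trans (by linarith [hec t])
  have hL := aux_rho γ hγ0 hγ1 P hP d0 hd0 πE hπE (fun s a => if f s ≠ a then (1 : ℝ) else 0)
  rw [hL]
  change _ ≤ 2 * Rmax / (1 - γ) ^ 2 * ((1 - γ) * ∑' t, γ ^ t * b t)
  have habs : ∀ (d : S → ℝ) (π : S → A → ℝ), IsProbVec d → IsPolicy π →
      |∑ s, ∑ a, d s * π s a * r s a| ≤ Rmax := by
    intro d π hd hπ
    have : |∑ s, ∑ a, d s * π s a * r s a| ≤ ∑ s, ∑ a, d s * π s a * Rmax := by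
      refine (Finset.abs_sum_le_sum_abs _ _).trans (Finset.sum_le_sum fun s _ => ?_)
      refine (Finset.abs_sum_le_sum_abs _ _).trans (Finset.sum_le_sum fun a _ => ?_)
      have h0 := mul_nonneg (hd.1 s) ((hπ s).1 a)
      rw [abs_mul, abs_of_nonneg h0]
      exact mul_le_mul_of_nonneg_left (hr s a) h0
    simp_rw [← Finset.sum_mul] at this
    rwa [aux_sa d hd π hπ, one_mul] at this
  have hV : |policyValue γ P r (detPol f) d0 - policyValue γ P r πE d0| ≤
      Rmax * ∑' t, γ ^ t * c t := by
    unfold policyValue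
    rw [← Summable.tsum_sub
      (aux_summable γ hγ0 hγ1 _ Rmax fun t => habs _ _ (hq t) hf)
      (aux_summable γ hγ0 hγ1 _ Rmax fun t => habs _ _ (hp t) hπE), ← tsum_mul_left]
    rw [← Real.norm_eq_abs]
    refine tsum_of_norm_bounded (hsc.mul_left Rmax).hasSum fun t => ?_
    rw [← mul_sub, Real.norm_eq_abs, abs_mul, abs_of_nonneg (pow_nonneg hγ0.le t),
      mul_left_comm]
    refine mul_le_mul_of_nonneg_left ?_ (pow_nonneg hγ0.le t)
    rw [abs_sub_comm]
    simp_rw [← Finset.sum_sub_distrib, ← sub_mul]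
    simp only [c, Finset.mul_sum]
    refine (Finset.abs_sum_le_sum_abs _ _).trans (Finset.sum_le_sum fun s _ => ?_)
    refine (Finset.abs_sum_le_sum_abs _ _).trans (Finset.sum_le_sum fun a _ => ?_)
    rw [abs_mul, mul_comm]
    exact mul_le_mul_of_nonneg_right (hr s a) (abs_nonneg _)
  refine hV.trans ?_
  have h5 : ∑' t, γ ^ t * c t ≤ 2 * (∑' t, γ ^ t * b t) / (1 - γ) := by
    rw [le_div_iff₀ hg]; linarith
  refine (mul_le_mul_of_nonneg_left h5 hR).trans (le_of_eq ?_)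
  field_simp

lemma aux_biUnion {ι Y : Type*} [DecidableEq ι] [DecidableEq Y] (w : Y → ℝ) (hw : ∀ y, 0 ≤ w y)
    (B : ι → Finset Y) (s : Finset ι) :
    ∑ y ∈ s.biUnion B, w y ≤ ∑ i ∈ s, ∑ y ∈ B i, w y := by
  induction s using Finset.induction_on with
  | empty => simp
  | insert a s ha ih =>
    rw [Finset.biUnion_insert, Finset.sum_insert ha]
    have h := Finset.sum_union_inter (s₁ := B a) (s₂ := s.biUnion B) (f := w)
    have h2 : 0 ≤ ∑ y ∈ B a ∩ s.biUnion B, w y := Finset.sum_nonneg fun y _ => hw y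
    linarith

lemma aux_hoeff {X : Type*} [Fintype X] (ρ : X → ℝ) (hρ : IsProbVec ρ) (l : X → ℝ)
    (h0 : ∀ x, 0 ≤ l x) (h1 : ∀ x, l x ≤ 1) (t : ℝ) :
    ∑ x, ρ x * Real.exp (t * (l x - ∑ y, ρ y * l y)) ≤ Real.exp (t ^ 2 / 8) := by
  letI : MeasurableSpace X := ⊤
  haveI : MeasurableSingletonClass X := ⟨fun _ => trivial⟩
  have hs : ∑ x, ENNReal.ofReal (ρ x) = 1 := by
    rw [← ENNReal.ofReal_sum_of_nonneg (fun x _ => hρ.1 x), hρ.2, ENNReal.ofReal_one]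
  let p := PMF.ofFintype (fun x => ENNReal.ofReal (ρ x)) hs
  have hint : ∀ g : X → ℝ, ∫ a, g a ∂(p.toMeasure) = ∑ x, ρ x * g x := by
    intro g
    rw [PMF.integral_eq_sum]
    refine Finset.sum_congr rfl fun x _ => ?_
    simp [p, PMF.ofFintype_apply, ENNReal.toReal_ofReal (hρ.1 x)]
  have h := ProbabilityTheory.hasSubgaussianMGF_of_mem_Icc (μ := p.toMeasure) (X := l)
    (a := 0) (b := 1) (measurable_from_top.aemeasurable)
    (Filter.Eventually.of_forall fun x => ⟨h0 x, h1 x⟩)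
  have h2 := h.mgf_le t
  unfold ProbabilityTheory.mgf at h2
  rw [hint, hint] at h2
  refine h2.trans (le_of_eq ?_)
  congr 1
  simp
  ring

lemma aux_chern {X : Type*} [Fintype X] (ρ : X → ℝ) (hρ : IsProbVec ρ) (l : X → ℝ)
    (h0 : ∀ x, 0 ≤ l x) (h1 : ∀ x, l x ≤ 1) (m : ℕ) (hm : 0 < m) (ε : ℝ) (hε : 0 ≤ ε)
    (B : Finset (Fin m → X))
    (hB : ∀ ω ∈ B, (1 / (m : ℝ)) * ∑ i, l (ω i) + ε ≤ ∑ y, ρ y * l y) :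
    ∑ ω ∈ B, ∏ i, ρ (ω i) ≤ Real.exp (-(2 * m * ε ^ 2)) := by
  have hm' : (0 : ℝ) < m := by exact_mod_cast hm
  set L := ∑ y, ρ y * l y with hL
  have hnn : ∀ ω : Fin m → X, 0 ≤ ∏ i, ρ (ω i) := fun ω => Finset.prod_nonneg fun i _ => hρ.1 _
  have hb : ∀ ω : Fin m → X, ω ∈ B → ∏ i, ρ (ω i) ≤
      Real.exp (-(4 * m * ε ^ 2)) * ∏ i, (ρ (ω i) * Real.exp (-(4 * ε) * (l (ω i) - L))) := by
    intro ω hω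
    have h := hB ω hω
    rw [Finset.prod_mul_distrib, ← Real.exp_sum, mul_left_comm, ← Real.exp_add]
    refine le_mul_of_one_le_right (hnn ω) (Real.one_le_exp ?_)
    rw [← Finset.mul_sum, Finset.sum_sub_distrib]
    simp only [Finset.sum_const, Finset.card_univ, Fintype.card_fin, nsmul_eq_mul]
    have h2 : ∑ i, l (ω i) + m * ε ≤ m * L := by
      have := mul_le_mul_of_nonneg_left h hm'.le
      rw [mul_add, ← mul_assoc, mul_one_div_cancel hm'.ne', one_mul] at this
      exact this
    nlinarith [mul_le_mul_of_nonneg_left h2 hε]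
  calc ∑ ω ∈ B, ∏ i, ρ (ω i)
      ≤ ∑ ω ∈ B, Real.exp (-(4 * m * ε ^ 2)) *
          ∏ i, (ρ (ω i) * Real.exp (-(4 * ε) * (l (ω i) - L))) := Finset.sum_le_sum hb
    _ ≤ ∑ ω : Fin m → X, Real.exp (-(4 * m * ε ^ 2)) *
          ∏ i, (ρ (ω i) * Real.exp (-(4 * ε) * (l (ω i) - L))) := by
        refine Finset.sum_le_sum_of_subset_of_nonneg (Finset.subset_univ _) fun ω _ _ => ?_
        exact mul_nonneg (Real.exp_pos _).le (Finset.prod_nonneg fun i _ =>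
          mul_nonneg (hρ.1 _) (Real.exp_pos _).le)
    _ = Real.exp (-(4 * m * ε ^ 2)) *
          (∑ x, ρ x * Real.exp (-(4 * ε) * (l x - L))) ^ m := by
        rw [← Finset.mul_sum]
        congr 1
        have := Fintype.prod_sum (fun (_ : Fin m) x => ρ x * Real.exp (-(4 * ε) * (l x - L)))
        rw [← this]
        simp
    _ ≤ Real.exp (-(4 * m * ε ^ 2)) * (Real.exp ((-(4 * ε)) ^ 2 / 8)) ^ m := by
        refine mul_le_mul_of_nonneg_left (pow_le_pow_left₀ ?_
          (aux_hoeff ρ hρ l h0 h1 _) m) (Real.exp_pos _).le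
        exact Finset.sum_nonneg fun x _ => mul_nonneg (hρ.1 _) (Real.exp_pos _).le
    _ = Real.exp (-(2 * m * ε ^ 2)) := by
        rw [← Real.exp_nat_mul, ← Real.exp_add]
        congr 1
        ring


/-- Theorem 2: sample-complexity bound for the behavioral cloning value gap.
With probability at least `1-δ` over `m` i.i.d. samples from `ρ_{π_E}`, every deterministic
policy `π_bc` satisfies a value-gap bound in terms of its empirical 0-1 risk. -/
theorem bc_value_generalization {S A : Type*} [Fintype S] [Fintype A] [DecidableEq A]
    [MeasurableSpace S] [MeasurableSpace A]
    (γ : ℝ) (hγ0 : 0 < γ) (hγ1 : γ < 1)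
    (P : S → A → S → ℝ) (hP : IsKernel P)
    (d0 : S → ℝ) (hd0 : IsProbVec d0)
    (r : S → A → ℝ) (Rmax : ℝ) (hr : ∀ s a, |r s a| ≤ Rmax)
    (πE : S → A → ℝ) (hπE : IsPolicy πE)
    (μ : Measure (S × A)) [IsProbabilityMeasure μ]
    (hμ : ∀ x : S × A, μ {x} = ENNReal.ofReal (discSADist γ P πE d0 x))
    (m : ℕ) (hm : 0 < m) (δ : ℝ) (hδ : 0 < δ) :
    ENNReal.ofReal (1 - δ) ≤
      (Measure.pi fun _ : Fin m => μ)
        {ω : Fin m → S × A | ∀ f : S → A,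
          |policyValue γ P r (detPol f) d0 - policyValue γ P r πE d0| ≤
            2 * Rmax / (1 - γ) ^ 2 *
              ((1 / (m : ℝ)) * ∑ i : Fin m, (if f (ω i).1 ≠ (ω i).2 then (1 : ℝ) else 0) +
                Real.sqrt
                  ((Real.log ((Fintype.card A : ℝ) ^ Fintype.card S) + Real.log (2 / δ)) /
                    (2 * m))) } := by
  classical
  have hSne : Nonempty S := by
    by_contra h
    rw [not_nonempty_iff] at h
    have := hd0.2
    simp at this
  have hAne : Nonempty A := by
    by_contra h
    rw [not_nonempty_iff] at h
    have := (hπE hSne.some).2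
    simp at this
  have hR : 0 ≤ Rmax := (abs_nonneg _).trans (hr hSne.some hAne.some)
  by_cases hδ1 : 1 ≤ δ
  · rw [ENNReal.ofReal_of_nonpos (by linarith)]; exact zero_le
  push Not at hδ1
  have hm' : (0 : ℝ) < m := by exact_mod_cast hm
  set N : ℝ := (Fintype.card A : ℝ) ^ Fintype.card S with hN
  have hN1 : 1 ≤ N := one_le_pow₀ (by exact_mod_cast Fintype.card_pos)
  set K : ℝ := Real.log N + Real.log (2 / δ) with hK
  have hK0 : 0 ≤ K := add_nonneg (Real.log_nonneg hN1)
    (Real.log_nonneg (by rw [le_div_iff₀ hδ]; linarith))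
  set ε := Real.sqrt (K / (2 * m)) with hε
  have hε0 : 0 ≤ ε := Real.sqrt_nonneg _
  have hexp : Real.exp (-(2 * m * ε ^ 2)) = δ / 2 / N := by
    rw [hε, Real.sq_sqrt (by positivity), mul_div_cancel₀ _ (by positivity), hK, neg_add,
      Real.exp_add, Real.exp_neg, Real.exp_neg, Real.exp_log (by linarith),
      Real.exp_log (by positivity)]
    field_simp
  have hρ := aux_rho_prob γ hγ0 hγ1 P hP d0 hd0 πE hπE
  set ρ := discSADist γ P πE d0 with hρdef
  set G := {ω : Fin m → S × A | ∀ f : S → A,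
          |policyValue γ P r (detPol f) d0 - policyValue γ P r πE d0| ≤
            2 * Rmax / (1 - γ) ^ 2 *
              ((1 / (m : ℝ)) * ∑ i : Fin m, (if f (ω i).1 ≠ (ω i).2 then (1 : ℝ) else 0) +
                ε) } with hG
  let B : (S → A) → Finset (Fin m → S × A) := fun f => Finset.univ.filter fun ω =>
    (1 / (m : ℝ)) * ∑ i, (if f (ω i).1 ≠ (ω i).2 then (1 : ℝ) else 0) + ε ≤
      ∑ y : S × A, ρ y * (if f y.1 ≠ y.2 then (1 : ℝ) else 0)
  let U : Finset (Fin m → S × A) := Finset.univ.biUnion B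
  have hnn : ∀ ω : Fin m → S × A, 0 ≤ ∏ i, ρ (ω i) := fun ω =>
    Finset.prod_nonneg fun i _ => hρ.1 _
  have hBf : ∀ f, ∑ ω ∈ B f, ∏ i, ρ (ω i) ≤ δ / 2 / N := by
    intro f
    rw [← hexp]
    refine aux_chern ρ hρ (fun y => if f y.1 ≠ y.2 then (1 : ℝ) else 0) ?_ ?_ m hm ε hε0 (B f) ?_
    · intro x; split_ifs <;> norm_num
    · intro x; split_ifs <;> norm_num
    · intro ω hω
      exact (Finset.mem_filter.1 hω).2
  have hU : ∑ ω ∈ U, ∏ i, ρ (ω i) ≤ δ := by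
    have h1 : ∑ ω ∈ U, ∏ i, ρ (ω i) ≤ ∑ f : S → A, ∑ ω ∈ B f, ∏ i, ρ (ω i) :=
      aux_biUnion _ hnn B Finset.univ
    have h2 : ∑ f : S → A, ∑ ω ∈ B f, ∏ i, ρ (ω i) ≤ ∑ f : S → A, δ / 2 / N :=
      Finset.sum_le_sum fun f _ => hBf f
    have h3 : ∑ f : S → A, δ / 2 / N = δ / 2 := by
      rw [Finset.sum_const, Finset.card_univ, Fintype.card_fun, nsmul_eq_mul, Nat.cast_pow, ← hN]
      field_simp
    linarith
  have hsub : Gᶜ ⊆ (U : Set (Fin m → S × A)) := by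
    intro ω hω
    by_contra hU'
    apply hω
    intro f
    have hf : ω ∉ B f := fun h => hU' (Finset.mem_coe.2
      (Finset.mem_biUnion.2 ⟨f, Finset.mem_univ f, h⟩))
    have hf' : ¬ _ := fun h => hf (Finset.mem_filter.2 ⟨Finset.mem_univ ω, h⟩)
    push Not at hf'
    refine (aux_det γ hγ0 hγ1 P hP d0 hd0 r Rmax hR hr πE hπE f).trans ?_
    refine mul_le_mul_of_nonneg_left ?_ (by positivity)
    simpa using hf'.le
  have hsing : ∀ ω : Fin m → S × A, (Measure.pi fun _ : Fin m => μ) {ω} =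
      ENNReal.ofReal (∏ i, ρ (ω i)) := by
    intro ω
    rw [← Set.univ_pi_singleton, Measure.pi_pi, ENNReal.ofReal_prod_of_nonneg
      (fun i _ => hρ.1 _)]
    exact Finset.prod_congr rfl fun i _ => hμ _
  have hGc : (Measure.pi fun _ : Fin m => μ) Gᶜ ≤ ENNReal.ofReal δ := by
    refine (measure_mono hsub).trans ?_
    have : (U : Set (Fin m → S × A)) = ⋃ ω ∈ U, {ω} := by ext; simp
    rw [this]
    refine (measure_biUnion_finset_le _ _).trans ?_
    simp_rw [hsing]
    rw [← ENNReal.ofReal_sum_of_nonneg (fun ω _ => hnn ω)]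
    exact ENNReal.ofReal_le_ofReal hU
  rw [ENNReal.ofReal_sub _ hδ.le, ENNReal.ofReal_one, tsub_le_iff_right]
  calc (1 : ENNReal) = (Measure.pi fun _ : Fin m => μ) Set.univ := measure_univ.symm
    _ = (Measure.pi fun _ : Fin m => μ) (G ∪ Gᶜ) := by rw [Set.union_compl_self]
    _ ≤ (Measure.pi fun _ : Fin m => μ) G + (Measure.pi fun _ : Fin m => μ) Gᶜ :=
        measure_union_le _ _
    _ ≤ _ := by gcongr
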